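/- Let X and Y be finite subsets of ℝ with |X| ≥ 2, |Y| ≥ 2 and (|X|, |Y|) ≠ (2, 2). Then there exists a pointwise finite-dimensional persistence module M over the product poset X × Y such that: (1) M is not interval-decomposable; (2) for every square Q of X × Y, the restriction of M to Q is interval-decomposable with every summand isomorphic to the indicator module of a rectangle of Q or of the top hook {b, c, d}. Moreover, the same statement holds with the top hook {b, c, d} replaced by the bottom hook {a, b, c}. -/

import Mathlib

open CategoryTheory Limits Set

noncomputable section

set_option linter.unusedSectionVars false

attribute [local instance] Classical.propDecidable

namespace PersistencePaper

/-- A persistence module over a poset `P`, with coefficients in a field `k`: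
a functor from `P` (viewed as a category) to the category of `k`-vector spaces. -/
abbrev PersistenceModule (k : Type) [Field k] (P : Type) [Preorder P] : Type 1 :=
  P ⥤ ModuleCat k

variable (k : Type) [Field k]

section Indicator

variable {P : Type} [Preorder P]

/-- The fiber of the indicator module of a set `Q ⊆ P` at a point `t : P`,
realized as a submodule of `k`: it is all of `k` when `t ∈ Q` and `0` otherwise. -/
def indSub (Q : Set P) (t : P) : Submodule k k where
  carrier := {x | t ∉ Q → x = 0}
  add_mem' := by intro a b ha hb ht; rw [ha ht, hb ht, add_zero]
  zero_mem' := fun _ => rfl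
  smul_mem' := by intro c x hx ht; rw [hx ht, smul_zero]

/-- The structure map of the indicator module: the identity when both endpoints lie in
`Q`, and zero otherwise. -/
def indMap (Q : Set P) (s t : P) : indSub k Q s →ₗ[k] indSub k Q t where
  toFun x := ⟨if s ∈ Q ∧ t ∈ Q then (x : k) else 0, by
    intro ht
    split_ifs with h
    · exact absurd h.2 ht
    · rfl⟩
  map_add' x y := by apply Subtype.ext; split_ifs <;> simp
  map_smul' c x := by apply Subtype.ext; split_ifs <;> simp

theorem indMap_coe (Q : Set P) (s t : P) (x : indSub k Q s) :
    (indMap k Q s t x : k) = if s ∈ Q ∧ t ∈ Q then (x : k) else 0 := rfl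

/-- The indicator persistence module `k_Q` of a convex subset `Q` of a poset `P`:
it assigns `k` to points of `Q` and `0` elsewhere, the structure maps being the identity
between points of `Q` and zero otherwise. -/
def indicator (Q : Set P) (hQ : Q.OrdConnected) : PersistenceModule k P where
  obj t := ModuleCat.of k (indSub k Q t)
  map {s t} _ := ModuleCat.ofHom (indMap k Q s t)
  map_id t := by
    refine ModuleCat.hom_ext <| LinearMap.ext fun (x : indSub k Q t) => Subtype.ext ?_
    show (indMap k Q t t x).val = Subtype.val x
    rw [indMap_coe]
    split_ifs with h
    · rfl
    · exact (x.2 fun ht => h ⟨ht, ht⟩).symm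
  map_comp {s t u} f g := by
    refine ModuleCat.hom_ext <| LinearMap.ext fun (x : indSub k Q s) => Subtype.ext ?_
    show (indMap k Q s u x).val = (indMap k Q t u (indMap k Q s t x)).val
    rw [indMap_coe, indMap_coe, indMap_coe]
    by_cases hs : s ∈ Q <;> by_cases hu : u ∈ Q
    · have ht : t ∈ Q := hQ.out hs hu ⟨leOfHom f, leOfHom g⟩
      simp [hs, ht, hu]
    · simp [hs, hu]
    · simp [hs, hu]
    · simp [hs, hu]

/-- The structure map `ρ_s^t : M_s → M_t` of a persistence module, as a linear map. -/
def rho (M : PersistenceModule k P) {s t : P} (h : s ≤ t) : M.obj s →ₗ[k] M.obj t :=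
  (M.map (homOfLE h)).hom

/-- The rank invariant `r(s,t)` of a persistence module: the rank of `ρ_s^t` when `s ≤ t`,
and `0` (by convention) otherwise. -/
def rk (M : PersistenceModule k P) (s t : P) : ℕ :=
  if h : s ≤ t then Module.finrank k (LinearMap.range (rho k M h)) else 0

/-- A persistence module is pointwise finite-dimensional (pfd) if all its spaces are
finite-dimensional. -/
def Pfd (M : PersistenceModule k P) : Prop :=
  ∀ t : P, FiniteDimensional k (M.obj t)

/-- An interval of a poset: a nonempty, convex and zigzag-connected subset. -/
def IsInterval (Q : Set P) : Prop :=
  Q.Nonempty ∧ Q.OrdConnected ∧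
    ∀ p ∈ Q, ∀ q ∈ Q,
      Relation.ReflTransGen (fun a b => a ∈ Q ∧ b ∈ Q ∧ (a ≤ b ∨ b ≤ a)) p q

/-- A persistence module is interval-decomposable if it is isomorphic to a direct sum
of indicator modules of intervals. -/
def IntervalDecomposable (M : PersistenceModule k P) : Prop :=
  ∃ (ι : Type) (I : ι → Set P) (hI : ∀ i, IsInterval (I i)),
    Nonempty (M ≅ ∐ fun i => indicator k (I i) (hI i).2.1)

end Indicator

section Rect

variable {X Y : Type} [Preorder X] [Preorder Y]

/-- A rectangle in the product poset `X × Y`: a nonempty product `I ×ˢ J` of an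
interval (convex subset) of `X` with an interval of `Y`. -/
def IsRectangle (R : Set (X × Y)) : Prop :=
  R.Nonempty ∧ ∃ (I : Set X) (J : Set Y), I.OrdConnected ∧ J.OrdConnected ∧ R = I ×ˢ J

theorem IsRectangle.ordConnected {R : Set (X × Y)} (h : IsRectangle R) :
    R.OrdConnected := by
  obtain ⟨-, I, J, hI, hJ, rfl⟩ := h
  constructor
  intro x hx y hy z hz
  exact ⟨hI.out hx.1 hy.1 ⟨hz.1.1, hz.2.1⟩, hJ.out hx.2 hy.2 ⟨hz.1.2, hz.2.2⟩⟩

/-- A persistence bimodule is rectangle-decomposable if it is isomorphic to a direct sum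
of indicator (rectangle) modules of rectangles. -/
def RectangleDecomposable (M : PersistenceModule k (X × Y)) : Prop :=
  ∃ (ι : Type) (R : ι → Set (X × Y)) (hR : ∀ i, IsRectangle (R i)),
    Nonempty (M ≅ ∐ fun i => indicator k (R i) (hR i).ordConnected)

/-- A persistence bimodule `M` over `X × Y` is weakly exact if for all `s ≤ t`,
`Im ρ_s^t = Im ρ_{(t₁,s₂)}^t ∩ Im ρ_{(s₁,t₂)}^t` and
`Ker ρ_s^t = Ker ρ_s^{(t₁,s₂)} + Ker ρ_s^{(s₁,t₂)}`. -/
def WeaklyExact (M : PersistenceModule k (X × Y)) : Prop :=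
  ∀ (s t : X × Y) (h : s ≤ t),
    (LinearMap.range (rho k M h) =
        LinearMap.range (rho k M (show (t.1, s.2) ≤ t from ⟨le_refl t.1, h.2⟩)) ⊓
        LinearMap.range (rho k M (show (s.1, t.2) ≤ t from ⟨h.1, le_refl t.2⟩))) ∧
    (LinearMap.ker (rho k M h) =
        LinearMap.ker (rho k M (show s ≤ (t.1, s.2) from ⟨h.1, le_refl s.2⟩)) ⊔
        LinearMap.ker (rho k M (show s ≤ (s.1, t.2) from ⟨le_refl s.1, h.2⟩)))

/-- The space (fiber) of a persistence module at an index. -/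
abbrev fiber {k : Type} [Field k] {P : Type} [Preorder P]
    (M : PersistenceModule k P) (t : P) : ModuleCat k :=
  M.obj t

/-- Morphisms of persistence modules (natural transformations). -/
abbrev PMHom {k : Type} [Field k] {P : Type} [Preorder P]
    (M N : PersistenceModule k P) : Type :=
  M ⟶ N

/-- The component of a morphism of persistence modules at an index, as a linear map. -/
abbrev PMHom.appLin {k : Type} [Field k] {P : Type} [Preorder P]
    {M N : PersistenceModule k P} (f : PMHom M N) (t : P) :
    M.obj t →ₗ[k] N.obj t :=
  (f.app t).hom

/-- The restriction of a persistence module to a subset of its indexing poset. -/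
def restrict {P : Type} [Preorder P] (M : PersistenceModule k P) (S : Set P) :
    PersistenceModule k ↥S :=
  (show Monotone (Subtype.val : ↥S → P) from fun _ _ h => h).functor ⋙ M

/-- The pullback (restriction) of a persistence module along a monotone map of posets. -/
def restrictAlong {P R : Type} [Preorder P] [Preorder R] {f : R → P} (hf : Monotone f)
    (M : PersistenceModule k P) : PersistenceModule k R :=
  hf.functor ⋙ M

/-- The right Kan extension of a persistence module along a monotone map of posets. -/
def ranAlong {P R : Type} [Preorder P] [Preorder R] {f : P → R} (hf : Monotone f)
    (M : PersistenceModule k P) : PersistenceModule k R :=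
  hf.functor.ran.obj M

/-- `M` decomposes as a direct sum of indicator modules whose supports are drawn from
the family `A` of (convex) subsets of the indexing poset. -/
def DecomposesWithSupports {P : Type} [Preorder P] (M : PersistenceModule k P)
    (A : Set (Set P)) : Prop :=
  ∃ (ι : Type) (Q : ι → Set P) (_ : ∀ i, Q i ∈ A) (hconv : ∀ i, (Q i).OrdConnected),
    Nonempty (M ≅ ∐ fun i => indicator k (Q i) (hconv i))

end Rect

end PersistencePaper
namespace PersistencePaper

/-- Restrictions of `M` to every square `{a,b,c,d}` of `X × Y` decompose as direct sums
of indicator modules whose supports are among the nine rectangles of the square together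
with the extra subset `extra a b c d` (e.g. a hook). -/
def SquareRestrictionsDecompose (k : Type) [Field k] {X Y : Set ℝ}
    (M : PersistenceModule k (↥X × ↥Y))
    (extra : (↥X × ↥Y) → (↥X × ↥Y) → (↥X × ↥Y) → (↥X × ↥Y) → Set (↥X × ↥Y)) : Prop :=
  ∀ (x1 x2 : ↥X) (y1 y2 : ↥Y), x1 < x2 → y1 < y2 →
    DecomposesWithSupports k
      (restrict k M ({(x1, y1), (x2, y1), (x1, y2), (x2, y2)} : Set (↥X × ↥Y)))
      {Q | Subtype.val '' Q ∈
        ({{(x1, y1)}, {(x2, y1)}, {(x1, y2)}, {(x2, y2)},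
          {(x1, y1), (x2, y1)}, {(x1, y1), (x1, y2)},
          {(x2, y1), (x2, y2)}, {(x1, y2), (x2, y2)},
          {(x1, y1), (x2, y1), (x1, y2), (x2, y2)},
          extra (x1, y1) (x2, y1) (x1, y2) (x2, y2)} : Set (Set (↥X × ↥Y)))}

section Aux

abbrev TT := Fin 3 × Fin 2

structure Dat (k : Type) [Field k] where
  W : TT → Submodule k (k × k)
  l : TT → (k × k →ₗ[k] k × k)
  hl : ∀ s t, s ≤ t → ∀ x ∈ W s, l t x ∈ W t
  hid : ∀ t, ∀ x ∈ W t, l t x = x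
  hcomp : ∀ s t, s ≤ t → ∀ x, l t (l s x) = l t x

variable {k : Type} [Field k]

def Dat.mod (D : Dat k) {P : Type} [Preorder P] (F : P → TT) (hF : Monotone F) :
    PersistenceModule k P where
  obj p := ModuleCat.of k (D.W (F p))
  map {s t} h := ModuleCat.ofHom ((D.l (F t)).restrict (D.hl (F s) (F t) (hF (leOfHom h))))
  map_id t := by
    refine ModuleCat.hom_ext <| LinearMap.ext fun (x : D.W (F t)) => Subtype.ext ?_
    exact D.hid _ _ x.2
  map_comp {s t u} f g := by
    refine ModuleCat.hom_ext <| LinearMap.ext fun (x : D.W (F s)) => Subtype.ext ?_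
    exact (D.hcomp _ _ (hF (leOfHom g)) _).symm

structure Dat.Splits (D : Dat k) (C : Set TT) (Q : Fin 2 → Set TT) where
  v : Fin 2 → TT → k × k
  w : Fin 2 → TT → (k × k →ₗ[k] k)
  hv : ∀ i, ∀ t ∈ C, v i t ∈ D.W t
  w0 : ∀ i, ∀ t ∈ C, t ∉ Q i → w i t = 0
  v0 : ∀ i, ∀ t ∈ C, t ∉ Q i → v i t = 0
  nat : ∀ i, ∀ s ∈ C, ∀ t ∈ C, s ≤ t → s ∈ Q i → D.l t (v i s) = v i t
  dual : ∀ i, ∀ t ∈ C, t ∈ Q i → w i t (v i t) = 1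
  dual0 : ∀ i j, ∀ t ∈ C, i ≠ j → w i t (v j t) = 0
  tot : ∀ t ∈ C, ∀ x ∈ D.W t, ∑ i, w i t x • v i t = x

lemma Dat.Splits.wnat {D : Dat k} {C : Set TT} {Q : Fin 2 → Set TT} (h : D.Splits C Q)
    (i : Fin 2) (s : TT) (hs : s ∈ C) (t : TT) (ht : t ∈ C) (hst : s ≤ t) (x : k × k)
    (hx : x ∈ D.W s) :
    h.w i t (D.l t x) = if s ∈ Q i ∧ t ∈ Q i then h.w i s x else 0 := by
  have h1 : D.l t x = ∑ j, h.w j s x • h.v j t := by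
    conv_lhs => rw [← h.tot s hs x hx]
    rw [map_sum]
    refine Finset.sum_congr rfl fun j _ => ?_
    rw [map_smul]
    by_cases hj : s ∈ Q j
    · rw [h.nat j s hs t ht hst hj]
    · rw [h.w0 j s hs hj]; simp
  rw [h1, map_sum, Finset.sum_eq_single i]
  · rw [map_smul]
    by_cases hj : s ∈ Q i
    · by_cases hj' : t ∈ Q i
      · rw [h.dual i t ht hj']; simp [hj, hj']
      · rw [h.w0 i t ht hj']; simp [hj']
    · rw [h.w0 i s hs hj]; simp
  · intro j _ hj
    rw [map_smul, h.dual0 i j t ht hj.symm, smul_zero]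
  · simp

section crit
variable {D : Dat k} {C : Set TT} {Q : Fin 2 → Set TT} (h : D.Splits C Q)
  {P : Type} [Preorder P] (F : P → TT) (hF : Monotone F) (hC : ∀ p, F p ∈ C)

def Dat.Splits.inj (i : Fin 2) (hconv : (F ⁻¹' Q i).OrdConnected) :
    indicator k (F ⁻¹' Q i) hconv ⟶ D.mod F hF where
  app t := ModuleCat.ofHom
    { toFun := fun x : indSub k (F ⁻¹' Q i) t =>
        (⟨(x : k) • h.v i (F t), Submodule.smul_mem _ _ (h.hv i _ (hC t))⟩ : D.W (F t))
      map_add' := fun x y => Subtype.ext (by simp [add_smul])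
      map_smul' := fun c x => Subtype.ext (by simp [mul_smul]) }
  naturality s t f := by
    refine ModuleCat.hom_ext <| LinearMap.ext fun (x : indSub k (F ⁻¹' Q i) s) => Subtype.ext ?_
    show (if s ∈ F ⁻¹' Q i ∧ t ∈ F ⁻¹' Q i then (x : k) else 0) • h.v i (F t)
      = D.l (F t) ((x : k) • h.v i (F s))
    rw [map_smul]
    by_cases hs : F s ∈ Q i
    · rw [h.nat i _ (hC s) _ (hC t) (hF (leOfHom f)) hs]
      by_cases ht : F t ∈ Q i
      · simp [hs, ht]
      · rw [h.v0 i _ (hC t) ht]; simp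
    · have : (x : k) = 0 := x.2 hs
      simp [this]

def Dat.Splits.proj (i : Fin 2) (hconv : (F ⁻¹' Q i).OrdConnected) :
    D.mod F hF ⟶ indicator k (F ⁻¹' Q i) hconv where
  app t := ModuleCat.ofHom
    { toFun := fun x : D.W (F t) =>
        (⟨h.w i (F t) x, fun ht => by rw [h.w0 i _ (hC t) ht]; rfl⟩ : indSub k (F ⁻¹' Q i) t)
      map_add' := fun x y => Subtype.ext (by simp)
      map_smul' := fun c x => Subtype.ext (by simp) }
  naturality s t f := by
    refine ModuleCat.hom_ext <| LinearMap.ext fun (x : D.W (F s)) => Subtype.ext ?_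
    exact h.wnat i _ (hC s) _ (hC t) (hF (leOfHom f)) x x.2

lemma sum_app_coe {P : Type} [Preorder P] {M N : PersistenceModule k P} {ι : Type} (s : Finset ι)
    (f : ι → (M ⟶ N)) (p : P) (x : M.obj p) :
    ((∑ i ∈ s, f i).app p).hom x = ∑ i ∈ s, ((f i).app p).hom x := by
  induction s using Finset.induction_on with
  | empty => simp
  | insert a s ha ih => rw [Finset.sum_insert ha, Finset.sum_insert ha, ← ih]; rfl

lemma Dat.Splits.total (hconv : ∀ i, (F ⁻¹' Q i).OrdConnected) :
    ∑ i, h.proj F hF hC i (hconv i) ≫ h.inj F hF hC i (hconv i) = 𝟙 (D.mod F hF) := by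
  ext t x
  refine (sum_app_coe Finset.univ _ t x).trans (Subtype.ext ?_)
  refine Eq.trans ?_ (h.tot _ (hC t) x.1 x.2)
  rw [Fin.sum_univ_two, Fin.sum_univ_two]
  rfl

lemma Dat.Splits.inj_proj (i : Fin 2) (hconv : (F ⁻¹' Q i).OrdConnected) :
    h.inj F hF hC i hconv ≫ h.proj F hF hC i hconv = 𝟙 _ := by
  ext t (x : indSub k (F ⁻¹' Q i) t)
  refine Subtype.ext ?_
  show h.w i (F t) ((x : k) • h.v i (F t)) = (x : k)
  rw [map_smul]
  by_cases ht : F t ∈ Q i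
  · rw [h.dual i _ (hC t) ht]; simp
  · have : (x : k) = 0 := x.2 ht
    simp [this]

lemma Dat.Splits.inj_proj0 (i j : Fin 2) (hij : i ≠ j) (hconv : (F ⁻¹' Q i).OrdConnected)
    (hconv' : (F ⁻¹' Q j).OrdConnected) :
    h.inj F hF hC i hconv ≫ h.proj F hF hC j hconv' = 0 := by
  ext t (x : indSub k (F ⁻¹' Q i) t)
  refine Subtype.ext ?_
  show h.w j (F t) ((x : k) • h.v i (F t)) = 0
  rw [map_smul, h.dual0 j i _ (hC t) hij.symm, smul_zero]

include h hC in
lemma Dat.Splits.iso (hconv : ∀ i, (F ⁻¹' Q i).OrdConnected) :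
    Nonempty (D.mod F hF ≅ ∐ fun i : {i : Fin 2 // (F ⁻¹' Q i).Nonempty} =>
      indicator k (F ⁻¹' Q i.1) (hconv i.1)) := by
  have tot := h.total F hF hC hconv
  have tot' : ∑ i : {i : Fin 2 // (F ⁻¹' Q i).Nonempty},
      h.proj F hF hC i.1 (hconv i.1) ≫ h.inj F hF hC i.1 (hconv i.1) = 𝟙 (D.mod F hF) := by
    rw [← tot]
    refine Fintype.sum_of_injective Subtype.val Subtype.val_injective _ _ ?_ (fun _ => rfl)
    intro i hi
    have hn : ¬ (F ⁻¹' Q i).Nonempty := fun hn => hi ⟨⟨i, hn⟩, rfl⟩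
    have h0 : h.proj F hF hC i (hconv i) = 0 := by
      ext t x
      refine Subtype.ext ?_
      show h.w i (F t) x.1 = 0
      rw [h.w0 i _ (hC t) (fun ht => hn ⟨t, ht⟩)]; rfl
    rw [h0, zero_comp]
  let s : Cofan (fun i : {i : Fin 2 // (F ⁻¹' Q i).Nonempty} =>
      indicator k (F ⁻¹' Q i.1) (hconv i.1)) :=
    Cofan.mk (D.mod F hF) (fun i => h.inj F hF hC i.1 (hconv i.1))
  have hs : IsColimit s := Cofan.IsColimit.mk s
    (fun c => ∑ i : {i : Fin 2 // (F ⁻¹' Q i).Nonempty},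
      h.proj F hF hC i.1 (hconv i.1) ≫ c.inj i)
    (by
      intro c j
      show h.inj F hF hC j.1 (hconv j.1) ≫ _ = _
      rw [Preadditive.comp_sum, Finset.sum_eq_single j]
      · rw [← Category.assoc, h.inj_proj, Category.id_comp]
      · intro i _ hij
        rw [← Category.assoc, h.inj_proj0 F hF hC _ _ (fun e => hij (Subtype.ext e.symm)),
          zero_comp]
      · simp)
    (by
      intro c m hm
      rw [← Category.id_comp m]
      erw [← tot']
      rw [Preadditive.sum_comp]
      refine Finset.sum_congr rfl fun i _ => ?_
      rw [Category.assoc, ← hm i]; rfl)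
  exact ⟨hs.coconePointUniqueUpToIso (coproductIsCoproduct _)⟩
end crit

lemma not_dec {P : Type} [Preorder P] (M : PersistenceModule k P) (p : P)
    (hsc : ∀ e : M ⟶ M, ∃ c : k, ∀ x : M.obj p, (e.app p).hom x = c • x)
    (hdim : ∀ f : M.obj p →ₗ[k] k, ∃ x, x ≠ 0 ∧ f x = 0) :
    ¬ IntervalDecomposable k M := by
  rintro ⟨ι, I, hI, ⟨φ⟩⟩
  set G := fun i => indicator k (I i) (hI i).2.1 with hG
  have key : ∀ i, (Sigma.ι G i).app p = 0 := by
    intro i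
    let e : M ⟶ M := φ.hom ≫ Sigma.π G i ≫ Sigma.ι G i ≫ φ.inv
    obtain ⟨c, hc⟩ := hsc e
    let f : M.obj p →ₗ[k] k := (indSub k (I i) p).subtype ∘ₗ ((φ.hom ≫ Sigma.π G i).app p).hom
    obtain ⟨x, hx, hfx⟩ := hdim f
    have h0 : ((φ.hom ≫ Sigma.π G i).app p).hom x = 0 := Subtype.ext hfx
    have h1 : (e.app p).hom x = 0 := by
      have : e = (φ.hom ≫ Sigma.π G i) ≫ Sigma.ι G i ≫ φ.inv := by simp [e]
      rw [this, NatTrans.comp_app, ModuleCat.hom_comp, LinearMap.comp_apply, h0, map_zero]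
    have hc0 : c = 0 := by
      rw [hc] at h1
      exact (smul_eq_zero.1 h1).resolve_right hx
    have he : e.app p = 0 := by
      ext y
      rw [hc, hc0, zero_smul]; rfl
    have : Sigma.ι G i = (Sigma.ι G i ≫ φ.inv) ≫ e ≫ φ.hom := by
      simp [e]
    rw [this]
    simp only [NatTrans.comp_app]
    rw [he]; simp
  have hcol := isColimitOfPreserves ((evaluation P (ModuleCat k)).obj p) (coproductIsCoproduct G)
  have hid : 𝟙 ((∐ G).obj p) = 0 := by
    refine hcol.hom_ext fun j => ?_
    have : (Sigma.ι G j.as).app p = 0 := key j.as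
    erw [comp_zero]
    erw [Category.comp_id]
    exact this
  obtain ⟨x, hx, -⟩ := hdim 0
  apply hx
  have h2 : 𝟙 (M.obj p) = 0 := by
    have h3 : φ.hom.app p ≫ φ.inv.app p = 𝟙 (M.obj p) := by
      rw [← NatTrans.comp_app, φ.hom_inv_id, NatTrans.id_app]
    have h4 : φ.inv.app p = 0 := by
      rw [← Category.id_comp (φ.inv.app p)]
      exact (congrArg (· ≫ φ.inv.app p) hid).trans zero_comp
    rw [← h3, h4, comp_zero]
  have := congrArg (fun f => f.hom x) h2
  simpa using this

lemma supp_mem {Z : Type} (a b c d : Z) (q : Z → Prop) (E : Set Z)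
    (hne : ({s : ↥({a, b, c, d} : Set Z) | q s.1}).Nonempty)
    (h1 : q a → q d → q b ∧ q c)
    (hE : ((q b → q c → q d) ∧ E = {b, c, d}) ∨ ((q b → q c → q a) ∧ E = {a, b, c})) :
    Subtype.val '' {s : ↥({a, b, c, d} : Set Z) | q s.1} ∈
      ({{a}, {b}, {c}, {d}, {a, b}, {a, c}, {b, d}, {c, d}, {a, b, c, d}, E} : Set (Set Z)) := by
  have key : Subtype.val '' {s : ↥({a, b, c, d} : Set Z) | q s.1} =
      {p | (p = a ∧ q a) ∨ (p = b ∧ q b) ∨ (p = c ∧ q c) ∨ (p = d ∧ q d)} := by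
    ext p
    simp only [mem_image, mem_ofPred_eq, Subtype.exists, mem_insert_iff, mem_singleton_iff]
    constructor
    · rintro ⟨z, hz, hq, rfl⟩
      rcases hz with rfl | rfl | rfl | rfl <;> simp [hq]
    · rintro (⟨rfl, h⟩ | ⟨rfl, h⟩ | ⟨rfl, h⟩ | ⟨rfl, h⟩) <;> exact ⟨_, by simp, h, rfl⟩
  have hne' := hne.image Subtype.val
  rw [key] at hne' ⊢
  have e1 : ∀ a : Z, ({p | p = a} : Set Z) = {a} := fun _ => rfl
  have e2 : ∀ a b : Z, ({p | p = a ∨ p = b} : Set Z) = {a, b} := fun _ _ => rfl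
  have e3 : ∀ a b c : Z, ({p | p = a ∨ p = b ∨ p = c} : Set Z) = {a, b, c} := fun _ _ _ => rfl
  have e4 : ∀ a b c d : Z, ({p | p = a ∨ p = b ∨ p = c ∨ p = d} : Set Z) = {a, b, c, d} :=
    fun _ _ _ _ => rfl
  by_cases qa : q a <;> by_cases qb : q b <;> by_cases qc : q c <;> by_cases qd : q d <;>
    simp only [qa, qb, qc, qd, and_true, and_false, or_false, false_or, e1, e2, e3, e4, true_imp_iff,
      false_imp_iff, false_and, true_and, imp_false, not_true] at h1 hE hne' ⊢ <;>
    first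
    | (subst hE; simp; done)
    | (simp at hne'; done)
    | (simp; done)


def TL (D : Dat k) (tp : Bool) : Prop :=
  ∀ (i1 i2 : Fin 3) (j1 j2 : Fin 2), i1 ≤ i2 → j1 ≤ j2 →
    ∃ (C : Set TT) (Q : Fin 2 → Set TT), Nonempty (D.Splits C Q) ∧
      (∀ j, (i1, j) ∈ C ∧ (i2, j) ∈ C) ∧ (∀ i, (Q i).OrdConnected) ∧
      ∀ i, (i2, j1) ∈ Q i → (i1, j2) ∈ Q i → (bif tp then (i2, j2) else (i1, j1)) ∈ Q i

def extraOf (tp : Bool) {Z : Type} : Z → Z → Z → Z → Set Z :=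
  fun a b c d => bif tp then {b, c, d} else {a, b, c}

lemma squares {X Y : Set ℝ} (D : Dat k) (tp : Bool) (hD : TL D tp) (F : ↥X × ↥Y → TT)
    (hF : Monotone F)
    (hsq : ∀ (x1 x2 : ↥X) (y1 y2 : ↥Y), x1 < x2 → y1 < y2 →
      ∃ (i1 i2 : Fin 3) (j1 j2 : Fin 2), i1 ≤ i2 ∧ j1 ≤ j2 ∧ F (x1, y1) = (i1, j1) ∧
        F (x2, y2) = (i2, j2) ∧ ((F (x2, y1) = (i2, j1) ∧ F (x1, y2) = (i1, j2)) ∨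
          (F (x2, y1) = (i1, j2) ∧ F (x1, y2) = (i2, j1)))) :
    SquareRestrictionsDecompose k (D.mod F hF) (extraOf tp) := by
  intro x1 x2 y1 y2 hx hy
  obtain ⟨i1, i2, j1, j2, hi, hj, ha, hd, hbc⟩ := hsq x1 x2 y1 y2 hx hy
  obtain ⟨C, Q, ⟨h⟩, hC, hconv, hQ⟩ := hD i1 i2 j1 j2 hi hj
  set S : Set (↥X × ↥Y) := {(x1, y1), (x2, y1), (x1, y2), (x2, y2)} with hS
  have hFS : Monotone (fun s : S => F s.1) := fun s t hst => hF hst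
  have hCS : ∀ s : S, F s.1 ∈ C := by
    rintro ⟨s, hs⟩
    show F s ∈ C
    rcases hs with rfl | rfl | rfl | rfl
    · rw [ha]; exact (hC _).1
    · rcases hbc with ⟨h1, -⟩ | ⟨h1, -⟩ <;> rw [h1]
      exacts [(hC _).2, (hC _).1]
    · rcases hbc with ⟨-, h1⟩ | ⟨-, h1⟩ <;> rw [h1]
      exacts [(hC _).1, (hC _).2]
    · rw [hd]; exact (hC _).2
  have hconv' : ∀ i, ((fun s : S => F s.1) ⁻¹' Q i).OrdConnected :=
    fun i => (hconv i).preimage_mono hFS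
  have hiso := h.iso (fun s : S => F s.1) hFS hCS hconv'
  refine ⟨{i : Fin 2 // ((fun s : S => F s.1) ⁻¹' Q i).Nonempty},
    fun i => (fun s : S => F s.1) ⁻¹' Q i.1, ?_, fun i => hconv' i.1, hiso⟩
  rintro ⟨i, hi⟩
  refine supp_mem (x1, y1) (x2, y1) (x1, y2) (x2, y2) (fun p => F p ∈ Q i) _ hi ?_ ?_
  · intro qa qd
    exact ⟨(hconv i).out qa qd ⟨hF ⟨hx.le, le_rfl⟩, hF ⟨le_rfl, hy.le⟩⟩,
      (hconv i).out qa qd ⟨hF ⟨le_rfl, hy.le⟩, hF ⟨hx.le, le_rfl⟩⟩⟩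
  · have hq := hQ i
    cases tp
    · right
      refine ⟨fun qb qc => ?_, rfl⟩
      rcases hbc with ⟨h1, h2⟩ | ⟨h1, h2⟩ <;> rw [h1] at qb <;> rw [h2] at qc <;> rw [ha]
      exacts [hq qb qc, hq qc qb]
    · left
      refine ⟨fun qb qc => ?_, rfl⟩
      rcases hbc with ⟨h1, h2⟩ | ⟨h1, h2⟩ <;> rw [h1] at qb <;> rw [h2] at qc <;> rw [hd]
      exacts [hq qb qc, hq qc qb]

lemma twodim (V : Submodule k (k × k)) (hV : V = ⊤) (f : V →ₗ[k] k) :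
    ∃ x, x ≠ 0 ∧ f x = 0 := by
  subst hV
  let u1 : (⊤ : Submodule k (k × k)) := ⟨(1, 0), trivial⟩
  let u2 : (⊤ : Submodule k (k × k)) := ⟨(0, 1), trivial⟩
  by_cases h : f u1 = 0
  · exact ⟨u1, fun h => one_ne_zero (congrArg (fun z => z.1.1) h), h⟩
  · refine ⟨f u2 • u1 - f u1 • u2, fun h' => h ?_, ?_⟩
    · have := congrArg (fun z => z.1.2) h'
      simpa [u1, u2] using this
    · simp [mul_comm]

def NatE {P : Type} [Preorder P] (D : Dat k) (F : P → TT) (hF : Monotone F)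
    (e : D.mod F hF ⟶ D.mod F hF) (t : P) : D.W (F t) →ₗ[k] D.W (F t) := (e.app t).hom

lemma NatE_nat {P : Type} [Preorder P] (D : Dat k) (F : P → TT) (hF : Monotone F)
    (e : D.mod F hF ⟶ D.mod F hF) (s t : P) (h : s ≤ t) (x : D.W (F s)) (y : D.W (F t))
    (hy : y.1 = D.l (F t) x.1) :
    (NatE D F hF e t y).1 = D.l (F t) (NatE D F hF e s x).1 := by
  have h1 := e.naturality (homOfLE h)
  have h2 := congrArg (fun f => f.hom x) h1
  have h3 : y = (D.l (F t)).restrict (D.hl (F s) (F t) (hF h)) x := Subtype.ext hy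
  rw [h3]
  exact congrArg Subtype.val h2

lemma ends {P : Type} [Preorder P] (D : Dat k) (F : P → TT) (hF : Monotone F) (σ : TT → P)
    (hσ : Monotone σ) (hFσ : ∀ t, F (σ t) = t) (e : D.mod F hF ⟶ D.mod F hF) :
    ∃ g : ∀ t : TT, D.W t →ₗ[k] D.W t,
      (∀ s t, s ≤ t → ∀ (x : D.W s) (y : D.W t), y.1 = D.l t x.1 →
        (g t y).1 = D.l t (g s x).1) ∧
      ∀ (t : TT) (c : k), (∀ y, g t y = c • y) →
        ∀ x : (D.mod F hF).obj (σ t), (e.app (σ t)).hom x = c • x := by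
  let E : ∀ t : TT, D.W (F (σ t)) ≃ₗ[k] D.W t := fun t => LinearEquiv.ofEq _ _ (by rw [hFσ])
  refine ⟨fun t => (E t).toLinearMap ∘ₗ NatE D F hF e (σ t) ∘ₗ (E t).symm.toLinearMap, ?_, ?_⟩
  · intro s t hst x y hy
    have hl : D.l (F (σ t)) = D.l t := by rw [hFσ]
    have := NatE_nat D F hF e (σ s) (σ t) (hσ hst) ((E s).symm x) ((E t).symm y)
      (by rw [hl]; exact hy)
    rw [hl] at this
    exact this
  · intro t c h x
    have := h (E t x)
    have h2 := congrArg Subtype.val this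
    exact Subtype.ext h2

/-- module with dimensions `0 1 1` below and `1 2 1` above -/
def DA (k : Type) [Field k] : Dat k where
  W t :=
    { carrier := {x | (t.2 = 0 → t.1 ≠ 2 → x.1 = 0) ∧ (t.1 ≠ 1 → x.2 = 0)}
      add_mem' := by
        rintro a b ⟨h1, h2⟩ ⟨h3, h4⟩
        exact ⟨fun h h' => by simp [h1 h h', h3 h h'], fun h => by simp [h2 h, h4 h]⟩
      zero_mem' := by simp
      smul_mem' := by
        rintro c x ⟨h1, h2⟩
        exact ⟨fun h h' => by simp [h1 h h'], fun h => by simp [h2 h]⟩ }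
  l t := if t.1 = 2 then (LinearMap.fst k k k + LinearMap.snd k k k).prod 0 else LinearMap.id
  hl := by
    rintro ⟨s1, s2⟩ ⟨t1, t2⟩ ⟨h1, h2⟩ ⟨x, y⟩ ⟨h3, h4⟩
    fin_cases s1 <;> fin_cases t1 <;> fin_cases s2 <;> fin_cases t2 <;> simp_all
  hid := by
    rintro ⟨t1, t2⟩ ⟨x, y⟩ ⟨h3, h4⟩
    fin_cases t1 <;> fin_cases t2 <;> simp_all
  hcomp := by
    rintro ⟨s1, s2⟩ ⟨t1, t2⟩ ⟨h1, h2⟩ ⟨x, y⟩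
    fin_cases s1 <;> fin_cases t1 <;> simp_all

/-- module with dimensions `1 2 1` below and `1 1 0` above -/
def DB (k : Type) [Field k] : Dat k where
  W t :=
    { carrier := {x | (t.1 = 0 → x.1 = x.2) ∧ (t.1 = 2 → x.2 = 0) ∧
        (t.2 = 1 → t.1 ≠ 0 → x.1 = 0)}
      add_mem' := by
        rintro a b ⟨h1, h2, h5⟩ ⟨h3, h4, h6⟩
        exact ⟨fun h => by simp [h1 h, h3 h], fun h => by simp [h2 h, h4 h],
          fun h h' => by simp [h5 h h', h6 h h']⟩
      zero_mem' := by simp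
      smul_mem' := by
        rintro c x ⟨h1, h2, h3⟩
        exact ⟨fun h => by simp [h1 h], fun h => by simp [h2 h], fun h h' => by simp [h3 h h']⟩ }
  l t := (if t.2 = 1 ∧ t.1 ≠ 0 then 0 else LinearMap.fst k k k).prod
    (if t.1 = 2 then 0 else LinearMap.snd k k k)
  hl := by
    rintro ⟨s1, s2⟩ ⟨t1, t2⟩ ⟨h1, h2⟩ ⟨x, y⟩ ⟨h3, h4, h5⟩
    fin_cases s1 <;> fin_cases t1 <;> fin_cases s2 <;> fin_cases t2 <;> simp_all
  hid := by
    rintro ⟨t1, t2⟩ ⟨x, y⟩ ⟨h3, h4, h5⟩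
    fin_cases t1 <;> fin_cases t2 <;> simp_all
  hcomp := by
    rintro ⟨s1, s2⟩ ⟨t1, t2⟩ ⟨h1, h2⟩ ⟨x, y⟩
    fin_cases s1 <;> fin_cases t1 <;> fin_cases s2 <;> fin_cases t2 <;> simp_all

lemma mem_DA (t : TT) (x : k × k) :
    x ∈ (DA k).W t ↔ (t.2 = 0 → t.1 ≠ 2 → x.1 = 0) ∧ (t.1 ≠ 1 → x.2 = 0) := Iff.rfl

lemma mem_DB (t : TT) (x : k × k) :
    x ∈ (DB k).W t ↔ (t.1 = 0 → x.1 = x.2) ∧ (t.1 = 2 → x.2 = 0) ∧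
        (t.2 = 1 → t.1 ≠ 0 → x.1 = 0) := Iff.rfl

lemma DA_l (t : TT) (x : k × k) : (DA k).l t x = if t.1 = 2 then (x.1 + x.2, 0) else x := by
  simp only [DA]; split_ifs <;> simp

lemma DB_l (t : TT) (x : k × k) : (DB k).l t x =
    (if t.2 = 1 ∧ t.1 ≠ 0 then 0 else x.1, if t.1 = 2 then 0 else x.2) := by
  simp only [DB]; split_ifs <;> simp

lemma scal (V : Submodule k (k × k)) (g : V →ₗ[k] V) (u1 u2 : V) (hu1 : u1.1 = (1, 0))
    (hu2 : u2.1 = (0, 1)) (m1 : (g u1).1.2 = 0) (m2 : (g u2).1.1 = 0)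
    (m3 : (g u1).1.1 = (g u2).1.2) (x : V) : g x = (g u1).1.1 • x := by
  have hx : x = x.1.1 • u1 + x.1.2 • u2 := by
    refine Subtype.ext (Prod.ext ?_ ?_) <;> simp [hu1, hu2]
  have hg : g x = x.1.1 • g u1 + x.1.2 • g u2 := by
    conv_lhs => rw [hx]
    rw [map_add, map_smul, map_smul]
  refine Eq.trans hg (Subtype.ext (Prod.ext ?_ ?_))
  · show x.1.1 * (g u1).1.1 + x.1.2 * (g u2).1.1 = (g u1).1.1 * x.1.1
    rw [m2]; ring
  · show x.1.1 * (g u1).1.2 + x.1.2 * (g u2).1.2 = (g u1).1.1 * x.1.2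
    rw [m1, m3]; ring

lemma notA {P : Type} [Preorder P] (F : P → TT) (hF : Monotone F) (σ : TT → P)
    (hσ : Monotone σ) (hFσ : ∀ t, F (σ t) = t) :
    ¬ IntervalDecomposable k ((DA k).mod F hF) := by
  have hW : (DA k).W (1, 1) = ⊤ := by
    rw [eq_top_iff]; intro x _; rw [mem_DA]; simp
  refine not_dec _ (σ (1, 1)) ?_ (twodim _ (by rw [hFσ, hW]))
  intro e
  obtain ⟨g, hg, hsc⟩ := ends (DA k) F hF σ hσ hFσ e
  have hm : ∀ x : k × k, x ∈ (DA k).W (1, 1) := fun x => by rw [hW]; trivial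
  let u1 : (DA k).W (1, 1) := ⟨(1, 0), hm _⟩
  let u2 : (DA k).W (1, 1) := ⟨(0, 1), hm _⟩
  let a1 : (DA k).W (0, 1) := ⟨(1, 0), by rw [mem_DA]; simp⟩
  let a2 : (DA k).W (1, 0) := ⟨(0, 1), by rw [mem_DA]; simp⟩
  have h1 := hg (0, 1) (1, 1) (by simp) a1 u1 (by rw [DA_l]; simp [u1, a1])
  have h2 := hg (1, 0) (1, 1) (by simp) a2 u2 (by rw [DA_l]; simp [u2, a2])
  have h3 := hg (1, 1) (2, 1) (Prod.mk_le_mk.2 ⟨by simp, le_rfl⟩) (u1 - u2) 0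
    (by rw [DA_l]; simp [u1, u2]; rfl)
  have m1 : (g _ u1).1.2 = 0 := by
    have := (g _ a1).2
    rw [mem_DA] at this
    have h4 := this.2 (by simp)
    rw [DA_l, if_neg (by simp)] at h1
    exact (congrArg Prod.snd h1).trans h4
  have m2 : (g _ u2).1.1 = 0 := by
    have := (g _ a2).2
    rw [mem_DA] at this
    have h4 := this.1 (by simp) (by simp)
    rw [DA_l, if_neg (by simp)] at h2
    exact (congrArg Prod.fst h2).trans h4
  have m3 : (g _ u1).1.1 = (g _ u2).1.2 := by
    rw [map_zero, map_sub, DA_l, if_pos rfl] at h3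
    have h5 := congrArg Prod.fst h3
    simp [m1, m2] at h5
    linear_combination -h5
  exact ⟨_, hsc _ _ (scal _ (g (1, 1)) u1 u2 rfl rfl m1 m2 m3)⟩

lemma notB {P : Type} [Preorder P] (F : P → TT) (hF : Monotone F) (σ : TT → P)
    (hσ : Monotone σ) (hFσ : ∀ t, F (σ t) = t) :
    ¬ IntervalDecomposable k ((DB k).mod F hF) := by
  have hW : (DB k).W (1, 0) = ⊤ := by
    rw [eq_top_iff]; intro x _; rw [mem_DB]; simp
  refine not_dec _ (σ (1, 0)) ?_ (twodim _ (by rw [hFσ, hW]))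
  intro e
  obtain ⟨g, hg, hsc⟩ := ends (DB k) F hF σ hσ hFσ e
  have hm : ∀ x : k × k, x ∈ (DB k).W (1, 0) := fun x => by rw [hW]; trivial
  let u1 : (DB k).W (1, 0) := ⟨(1, 0), hm _⟩
  let u2 : (DB k).W (1, 0) := ⟨(0, 1), hm _⟩
  let a3 : (DB k).W (0, 0) := ⟨(1, 1), by rw [mem_DB]; simp⟩
  have h1 := hg (1, 0) (1, 1) (by simp) u1 0 (by rw [DB_l]; simp [u1]; rfl)
  have h2 := hg (1, 0) (2, 0) (Prod.mk_le_mk.2 ⟨by simp, le_rfl⟩) u2 0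
    (by rw [DB_l]; simp [u2]; rfl)
  have h3 := hg (0, 0) (1, 0) (by simp) a3 (u1 + u2) (by rw [DB_l]; simp [u1, u2, a3])
  have m1 : (g _ u1).1.2 = 0 := by
    rw [map_zero, DB_l] at h1
    have := congrArg Prod.snd h1
    simpa [eq_comm] using this
  have m2 : (g _ u2).1.1 = 0 := by
    rw [map_zero, DB_l] at h2
    have := congrArg Prod.fst h2
    simpa [eq_comm] using this
  have m3 : (g _ u1).1.1 = (g _ u2).1.2 := by
    have := (g _ a3).2
    rw [mem_DB] at this
    have h5 := this.1 rfl
    rw [map_add, DB_l] at h3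
    have h6 := congrArg Prod.fst h3
    have h7 := congrArg Prod.snd h3
    simp [m1, m2] at h6 h7
    rw [h6, h7]; exact h5
  exact ⟨_, hsc _ _ (scal _ (g (1, 0)) u1 u2 rfl rfl m1 m2 m3)⟩

/-- nonzero-column splitting data, three per module -/
def SA1 : (DA k).Splits {t | t.1 ≠ 2} ![{t | t.2 = 1}, {t | t.1 = 1}] where
  v := ![fun t => if t.2 = 1 then (1, 0) else 0, fun t => if t.1 = 1 then (0, 1) else 0]
  w := ![fun t => if t.2 = 1 then LinearMap.fst k k k else 0,
    fun t => if t.1 = 1 then LinearMap.snd k k k else 0]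
  hv := by
    rintro i ⟨t1, t2⟩ ht; rw [mem_DA]
    fin_cases i <;> fin_cases t1 <;> fin_cases t2 <;> simp_all
  w0 := by
    rintro i ⟨t1, t2⟩ ht
    fin_cases i <;> fin_cases t1 <;> fin_cases t2 <;> simp_all
  v0 := by
    rintro i ⟨t1, t2⟩ ht
    fin_cases i <;> fin_cases t1 <;> fin_cases t2 <;> simp_all
  nat := by
    rintro i ⟨s1, s2⟩ hs ⟨t1, t2⟩ ht ⟨h1, h2⟩ h3; rw [DA_l]
    fin_cases i <;> fin_cases t1 <;> fin_cases t2 <;> fin_cases s1 <;> fin_cases s2 <;> simp_all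
  dual := by
    rintro i ⟨t1, t2⟩ ht
    fin_cases i <;> fin_cases t1 <;> fin_cases t2 <;> simp_all
  dual0 := by
    rintro i j ⟨t1, t2⟩ ht
    fin_cases i <;> fin_cases j <;> fin_cases t1 <;> fin_cases t2 <;> simp_all
  tot := by
    rintro ⟨t1, t2⟩ ht ⟨x, y⟩ h; rw [mem_DA] at h
    rw [Fin.sum_univ_two]
    fin_cases t1 <;> fin_cases t2 <;> simp_all <;> rfl

def SA2 : (DA k).Splits {t | t.1 ≠ 0} ![{t | t.1 ≠ 0}, {t | t.1 = 1 ∧ t.2 = 1}] where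
  v := ![fun t => if t.1 = 1 then (0, 1) else if t.1 = 2 then (1, 0) else 0,
    fun t => if t.1 = 1 ∧ t.2 = 1 then (1, -1) else 0]
  w := ![fun t => if t.1 ≠ 0 then LinearMap.fst k k k + LinearMap.snd k k k else 0,
    fun t => if t.1 = 1 ∧ t.2 = 1 then LinearMap.fst k k k else 0]
  hv := by
    rintro i ⟨t1, t2⟩ ht; rw [mem_DA]
    fin_cases i <;> fin_cases t1 <;> fin_cases t2 <;> simp_all
  w0 := by
    rintro i ⟨t1, t2⟩ ht
    fin_cases i <;> fin_cases t1 <;> fin_cases t2 <;> simp_all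
  v0 := by
    rintro i ⟨t1, t2⟩ ht
    fin_cases i <;> fin_cases t1 <;> fin_cases t2 <;> simp_all
  nat := by
    rintro i ⟨s1, s2⟩ hs ⟨t1, t2⟩ ht ⟨h1, h2⟩ h3; rw [DA_l]
    fin_cases i <;> fin_cases t1 <;> fin_cases t2 <;> fin_cases s1 <;> fin_cases s2 <;> simp_all
  dual := by
    rintro i ⟨t1, t2⟩ ht
    fin_cases i <;> fin_cases t1 <;> fin_cases t2 <;> simp_all
  dual0 := by
    rintro i j ⟨t1, t2⟩ ht
    fin_cases i <;> fin_cases j <;> fin_cases t1 <;> fin_cases t2 <;> simp_all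
  tot := by
    rintro ⟨t1, t2⟩ ht ⟨x, y⟩ h; rw [mem_DA] at h
    rw [Fin.sum_univ_two]
    fin_cases t1 <;> fin_cases t2 <;> simp_all <;> rfl

def SA3 : (DA k).Splits {t | t.1 ≠ 1} ![{t | ¬ (t.1 = 0 ∧ t.2 = 0)}, ∅] where
  v := ![fun t => if t.1 = 0 ∧ t.2 = 0 then 0 else (1, 0), 0]
  w := ![fun t => if t.1 = 0 ∧ t.2 = 0 then 0 else LinearMap.fst k k k, 0]
  hv := by
    rintro i ⟨t1, t2⟩ ht; rw [mem_DA]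
    fin_cases i <;> fin_cases t1 <;> fin_cases t2 <;> simp_all
  w0 := by
    rintro i ⟨t1, t2⟩ ht
    fin_cases i <;> fin_cases t1 <;> fin_cases t2 <;> simp_all
  v0 := by
    rintro i ⟨t1, t2⟩ ht
    fin_cases i <;> fin_cases t1 <;> fin_cases t2 <;> simp_all
  nat := by
    rintro i ⟨s1, s2⟩ hs ⟨t1, t2⟩ ht ⟨h1, h2⟩ h3; rw [DA_l]
    fin_cases i <;> fin_cases t1 <;> fin_cases t2 <;> fin_cases s1 <;> fin_cases s2 <;> simp_all
  dual := by
    rintro i ⟨t1, t2⟩ ht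
    fin_cases i <;> fin_cases t1 <;> fin_cases t2 <;> simp_all
  dual0 := by
    rintro i j ⟨t1, t2⟩ ht
    fin_cases i <;> fin_cases j <;> fin_cases t1 <;> fin_cases t2 <;> simp_all
  tot := by
    rintro ⟨t1, t2⟩ ht ⟨x, y⟩ h; rw [mem_DA] at h
    rw [Fin.sum_univ_two]
    fin_cases t1 <;> fin_cases t2 <;> simp_all <;> rfl

def SB1 : (DB k).Splits {t | t.1 ≠ 2} ![{t | t.1 ≠ 2}, {t | t.1 = 1 ∧ t.2 = 0}] where
  v := ![fun t => if t.1 = 2 then 0 else if t.1 = 1 ∧ t.2 = 1 then (0, 1) else (1, 1),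
    fun t => if t.1 = 1 ∧ t.2 = 0 then (1, 0) else 0]
  w := ![fun t => if t.1 ≠ 2 then LinearMap.snd k k k else 0,
    fun t => if t.1 = 1 ∧ t.2 = 0 then LinearMap.fst k k k - LinearMap.snd k k k else 0]
  hv := by
    rintro i ⟨t1, t2⟩ ht; rw [mem_DB]
    fin_cases i <;> fin_cases t1 <;> fin_cases t2 <;> simp_all
  w0 := by
    rintro i ⟨t1, t2⟩ ht
    fin_cases i <;> fin_cases t1 <;> fin_cases t2 <;> simp_all
  v0 := by
    rintro i ⟨t1, t2⟩ ht
    fin_cases i <;> fin_cases t1 <;> fin_cases t2 <;> simp_all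
  nat := by
    rintro i ⟨s1, s2⟩ hs ⟨t1, t2⟩ ht ⟨h1, h2⟩ h3; rw [DB_l]
    fin_cases i <;> fin_cases t1 <;> fin_cases t2 <;> fin_cases s1 <;> fin_cases s2 <;> simp_all
  dual := by
    rintro i ⟨t1, t2⟩ ht
    fin_cases i <;> fin_cases t1 <;> fin_cases t2 <;> simp_all
  dual0 := by
    rintro i j ⟨t1, t2⟩ ht
    fin_cases i <;> fin_cases j <;> fin_cases t1 <;> fin_cases t2 <;> simp_all
  tot := by
    rintro ⟨t1, t2⟩ ht ⟨x, y⟩ h; rw [mem_DB] at h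
    rw [Fin.sum_univ_two]
    fin_cases t1 <;> fin_cases t2 <;> simp_all <;> rfl

def SB2 : (DB k).Splits {t | t.1 ≠ 0} ![{t | t.2 = 0}, {t | t.1 = 1}] where
  v := ![fun t => if t.2 = 0 then (1, 0) else 0, fun t => if t.1 = 1 then (0, 1) else 0]
  w := ![fun t => if t.2 = 0 then LinearMap.fst k k k else 0,
    fun t => if t.1 = 1 then LinearMap.snd k k k else 0]
  hv := by
    rintro i ⟨t1, t2⟩ ht; rw [mem_DB]
    fin_cases i <;> fin_cases t1 <;> fin_cases t2 <;> simp_all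
  w0 := by
    rintro i ⟨t1, t2⟩ ht
    fin_cases i <;> fin_cases t1 <;> fin_cases t2 <;> simp_all
  v0 := by
    rintro i ⟨t1, t2⟩ ht
    fin_cases i <;> fin_cases t1 <;> fin_cases t2 <;> simp_all
  nat := by
    rintro i ⟨s1, s2⟩ hs ⟨t1, t2⟩ ht ⟨h1, h2⟩ h3; rw [DB_l]
    fin_cases i <;> fin_cases t1 <;> fin_cases t2 <;> fin_cases s1 <;> fin_cases s2 <;> simp_all
  dual := by
    rintro i ⟨t1, t2⟩ ht
    fin_cases i <;> fin_cases t1 <;> fin_cases t2 <;> simp_all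
  dual0 := by
    rintro i j ⟨t1, t2⟩ ht
    fin_cases i <;> fin_cases j <;> fin_cases t1 <;> fin_cases t2 <;> simp_all
  tot := by
    rintro ⟨t1, t2⟩ ht ⟨x, y⟩ h; rw [mem_DB] at h
    rw [Fin.sum_univ_two]
    fin_cases t1 <;> fin_cases t2 <;> simp_all <;> rfl

def SB3 : (DB k).Splits {t | t.1 ≠ 1} ![{t | ¬ (t.1 = 2 ∧ t.2 = 1)}, ∅] where
  v := ![fun t => if t.1 = 0 then (1, 1) else if t.1 = 2 ∧ t.2 = 0 then (1, 0) else 0, 0]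
  w := ![fun t => if t.1 = 2 ∧ t.2 = 1 then 0 else LinearMap.fst k k k, 0]
  hv := by
    rintro i ⟨t1, t2⟩ ht; rw [mem_DB]
    fin_cases i <;> fin_cases t1 <;> fin_cases t2 <;> simp_all
  w0 := by
    rintro i ⟨t1, t2⟩ ht
    fin_cases i <;> fin_cases t1 <;> fin_cases t2 <;> simp_all
  v0 := by
    rintro i ⟨t1, t2⟩ ht
    fin_cases i <;> fin_cases t1 <;> fin_cases t2 <;> simp_all
  nat := by
    rintro i ⟨s1, s2⟩ hs ⟨t1, t2⟩ ht ⟨h1, h2⟩ h3; rw [DB_l]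
    fin_cases i <;> fin_cases t1 <;> fin_cases t2 <;> fin_cases s1 <;> fin_cases s2 <;> simp_all
  dual := by
    rintro i ⟨t1, t2⟩ ht
    fin_cases i <;> fin_cases t1 <;> fin_cases t2 <;> simp_all
  dual0 := by
    rintro i j ⟨t1, t2⟩ ht
    fin_cases i <;> fin_cases j <;> fin_cases t1 <;> fin_cases t2 <;> simp_all
  tot := by
    rintro ⟨t1, t2⟩ ht ⟨x, y⟩ h; rw [mem_DB] at h
    rw [Fin.sum_univ_two]
    fin_cases t1 <;> fin_cases t2 <;> simp_all <;> rfl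


lemma TLA : TL (DA k) true := by
  intro i1 i2 j1 j2 hi hj
  by_cases h2 : i2 = 2
  · by_cases h1 : i1 = 0
    · refine ⟨_, _, ⟨SA3⟩, by simp [h1, h2], ?_, ?_⟩
      · intro i
        refine ⟨?_⟩
        rintro ⟨a1, a2⟩ ha ⟨b1, b2⟩ hb ⟨c1, c2⟩ ⟨⟨h3, h4⟩, h5, h6⟩
        fin_cases i
        · simp at ha hb h3 h4 ⊢
          omega
        · simp at ha
      · intro i
        fin_cases i <;> simp
        omega
    · refine ⟨_, _, ⟨SA2⟩, by simp [h1, h2], ?_, ?_⟩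
      · intro i
        refine ⟨?_⟩
        rintro ⟨a1, a2⟩ ha ⟨b1, b2⟩ hb ⟨c1, c2⟩ ⟨⟨h3, h4⟩, h5, h6⟩
        fin_cases i
        · simp at ha hb h3 h4 h5 h6 ⊢
          omega
        · simp at ha hb h3 h4 h5 h6 ⊢
          omega
      · intro i
        fin_cases i <;> simp
        all_goals omega
  · refine ⟨_, _, ⟨SA1⟩, by simp; omega, ?_, ?_⟩
    · intro i
      refine ⟨?_⟩
      rintro ⟨a1, a2⟩ ha ⟨b1, b2⟩ hb ⟨c1, c2⟩ ⟨⟨h3, h4⟩, h5, h6⟩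
      fin_cases i
      · simp at ha hb h3 h4 h5 h6 ⊢
        omega
      · simp at ha hb h3 h4 h5 h6 ⊢
        omega
    · intro i
      fin_cases i <;> simp
      all_goals omega

lemma TLB : TL (DB k) false := by
  intro i1 i2 j1 j2 hi hj
  by_cases h2 : i2 = 2
  · by_cases h1 : i1 = 0
    · refine ⟨_, _, ⟨SB3⟩, by simp [h1, h2], ?_, ?_⟩
      · intro i
        refine ⟨?_⟩
        rintro ⟨a1, a2⟩ ha ⟨b1, b2⟩ hb ⟨c1, c2⟩ ⟨⟨h3, h4⟩, h5, h6⟩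
        fin_cases i
        · simp at ha hb h3 h4 h5 h6 ⊢
          omega
        · simp at ha
      · intro i
        fin_cases i <;> simp
        omega
    · refine ⟨_, _, ⟨SB2⟩, by simp [h1, h2], ?_, ?_⟩
      · intro i
        refine ⟨?_⟩
        rintro ⟨a1, a2⟩ ha ⟨b1, b2⟩ hb ⟨c1, c2⟩ ⟨⟨h3, h4⟩, h5, h6⟩
        fin_cases i
        · simp at ha hb h3 h4 h5 h6 ⊢
          omega
        · simp at ha hb h3 h4 h5 h6 ⊢
          omega
      · intro i
        fin_cases i <;> simp
        all_goals omega
  · refine ⟨_, _, ⟨SB1⟩, by simp; omega, ?_, ?_⟩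
    · intro i
      refine ⟨?_⟩
      rintro ⟨a1, a2⟩ ha ⟨b1, b2⟩ hb ⟨c1, c2⟩ ⟨⟨h3, h4⟩, h5, h6⟩
      fin_cases i
      · simp at ha hb h3 h4 h5 h6 ⊢
        omega
      · simp at ha hb h3 h4 h5 h6 ⊢
        omega
    · intro i
      fin_cases i <;> simp
      all_goals omega

lemma exists3 (X : Set ℝ) (h : 2 < X.ncard) :
    ∃ (f : X → Fin 3) (τ : Fin 3 → X), Monotone f ∧ Monotone τ ∧ ∀ i, f (τ i) = i := by
  have hfin : X.Finite := Set.finite_of_ncard_pos (by omega)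
  obtain ⟨a, b, c, hab, hbc⟩ : ∃ a b c : X, a < b ∧ b < c := by
    obtain ⟨a, ha, b, hb, c, hc, h1, h2, h3⟩ := (Set.two_lt_ncard hfin).1 h
    rcases lt_or_gt_of_ne h1 with h1 | h1 <;> rcases lt_or_gt_of_ne h2 with h2 | h2 <;>
      rcases lt_or_gt_of_ne h3 with h3 | h3
    · exact ⟨⟨a, ha⟩, ⟨b, hb⟩, ⟨c, hc⟩, h1, h3⟩
    · exact ⟨⟨a, ha⟩, ⟨c, hc⟩, ⟨b, hb⟩, h2, h3⟩
    · linarith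
    · exact ⟨⟨c, hc⟩, ⟨a, ha⟩, ⟨b, hb⟩, h2, h1⟩
    · exact ⟨⟨b, hb⟩, ⟨a, ha⟩, ⟨c, hc⟩, h1, h2⟩
    · linarith
    · exact ⟨⟨b, hb⟩, ⟨c, hc⟩, ⟨a, ha⟩, h3, h2⟩
    · exact ⟨⟨c, hc⟩, ⟨b, hb⟩, ⟨a, ha⟩, h3, h1⟩
  refine ⟨fun x => if x < b then 0 else if x < c then 1 else 2, ![a, b, c], ?_, ?_, ?_⟩
  · intro x y hxy
    show (if x < b then (0 : Fin 3) else if x < c then 1 else 2)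
      ≤ if y < b then 0 else if y < c then 1 else 2
    by_cases h1 : y < b
    · simp [h1, hxy.trans_lt h1]
    · by_cases h2 : y < c
      · simp only [h1, h2, hxy.trans_lt h2, if_true, if_false]
        split_ifs <;> simp
      · simp only [h1, h2, if_false]
        exact Fin.le_last _
  · intro i j hij
    fin_cases i <;> fin_cases j <;> simp at hij ⊢
    exacts [hab.le, (hab.trans hbc).le, hbc.le]
  · intro i
    fin_cases i <;> simp [hab, hbc, hbc.le, (hab.trans hbc).le]

lemma exists2 (X : Set ℝ) (h : 1 < X.ncard) :
    ∃ (f : X → Fin 2) (τ : Fin 2 → X), Monotone f ∧ Monotone τ ∧ ∀ i, f (τ i) = i := by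
  have hfin : X.Finite := Set.finite_of_ncard_pos (by omega)
  obtain ⟨a, b, hab⟩ : ∃ a b : X, a < b := by
    obtain ⟨a, b, ha, hb, h1⟩ := (Set.one_lt_ncard_iff hfin).1 h
    rcases lt_or_gt_of_ne h1 with h1 | h1
    · exact ⟨⟨a, ha⟩, ⟨b, hb⟩, h1⟩
    · exact ⟨⟨b, hb⟩, ⟨a, ha⟩, h1⟩
  refine ⟨fun x => if x < b then 0 else 1, ![a, b], ?_, ?_, ?_⟩
  · intro x y hxy
    show (if x < b then (0 : Fin 2) else 1) ≤ if y < b then 0 else 1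
    by_cases h1 : y < b
    · simp [h1, hxy.trans_lt h1]
    · simp only [h1, if_false]
      exact Fin.le_last _
  · intro i j hij
    fin_cases i <;> fin_cases j <;> simp at hij ⊢
    exact hab.le
  · intro i
    fin_cases i <;> simp [hab]

lemma existsF (X Y : Set ℝ) (hX2 : 2 ≤ X.ncard) (hY2 : 2 ≤ Y.ncard)
    (hne : ¬(X.ncard = 2 ∧ Y.ncard = 2)) :
    ∃ (F : ↥X × ↥Y → TT) (σ : TT → ↥X × ↥Y), Monotone F ∧ Monotone σ ∧ (∀ t, F (σ t) = t) ∧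
    ∀ (x1 x2 : ↥X) (y1 y2 : ↥Y), x1 < x2 → y1 < y2 →
      ∃ (i1 i2 : Fin 3) (j1 j2 : Fin 2), i1 ≤ i2 ∧ j1 ≤ j2 ∧ F (x1, y1) = (i1, j1) ∧
        F (x2, y2) = (i2, j2) ∧ ((F (x2, y1) = (i2, j1) ∧ F (x1, y2) = (i1, j2)) ∨
          (F (x2, y1) = (i1, j2) ∧ F (x1, y2) = (i2, j1))) := by
  by_cases h : 2 < X.ncard
  · obtain ⟨f, τ, hf, hτ, hfτ⟩ := exists3 X h
    obtain ⟨g, ρ, hg, hρ, hgρ⟩ := exists2 Y hY2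
    refine ⟨fun p => (f p.1, g p.2), fun t => (τ t.1, ρ t.2), fun p q h => ⟨hf h.1, hg h.2⟩,
      fun p q h => ⟨hτ h.1, hρ h.2⟩, fun t => Prod.ext (hfτ _) (hgρ _), ?_⟩
    intro x1 x2 y1 y2 hx hy
    exact ⟨_, _, _, _, hf hx.le, hg hy.le, rfl, rfl, Or.inl ⟨rfl, rfl⟩⟩
  · obtain ⟨f, τ, hf, hτ, hfτ⟩ := exists3 Y (by omega)
    obtain ⟨g, ρ, hg, hρ, hgρ⟩ := exists2 X hX2
    refine ⟨fun p => (f p.2, g p.1), fun t => (ρ t.2, τ t.1), fun p q h => ⟨hf h.2, hg h.1⟩,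
      fun p q h => ⟨hρ h.2, hτ h.1⟩, fun t => Prod.ext (hfτ _) (hgρ _), ?_⟩
    intro x1 x2 y1 y2 hx hy
    exact ⟨_, _, _, _, hf hy.le, hg hx.le, rfl, rfl, Or.inr ⟨rfl, rfl⟩⟩

lemma pfd_mod {P : Type} [Preorder P] (D : Dat k) (F : P → TT) (hF : Monotone F) :
    Pfd k (D.mod F hF) := fun t =>
  inferInstanceAs (FiniteDimensional k (D.W (F t)))

end Aux

/-- For finite `X, Y ⊆ ℝ` with `|X|, |Y| ≥ 2` and `(|X|,|Y|) ≠ (2,2)`,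
there is a pfd persistence module over `X × Y` that is not interval-decomposable, while
its restriction to every square is interval-decomposable with all summands supported on
rectangles of the square or on the top hook `{b,c,d}`; and the same holds with the top
hook replaced by the bottom hook `{a,b,c}`. -/
theorem exists_not_intervalDecomposable_but_square_decomposable_with_hooks
    (k : Type) [Field k] (X Y : Set ℝ) (hX : X.Finite) (hY : Y.Finite)
    (hX2 : 2 ≤ X.ncard) (hY2 : 2 ≤ Y.ncard) (hne : ¬(X.ncard = 2 ∧ Y.ncard = 2)) :
    (∃ M : PersistenceModule k (↥X × ↥Y),
      Pfd k M ∧ ¬ IntervalDecomposable k M ∧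
        SquareRestrictionsDecompose k M (fun _ b c d => {b, c, d})) ∧
    (∃ M : PersistenceModule k (↥X × ↥Y),
      Pfd k M ∧ ¬ IntervalDecomposable k M ∧
        SquareRestrictionsDecompose k M (fun a b c _ => {a, b, c})) := by
  obtain ⟨F, σ, hF, hσ, hFσ, hsq⟩ := existsF X Y hX2 hY2 hne
  exact ⟨⟨(DA k).mod F hF, pfd_mod _ _ _, notA F hF σ hσ hFσ, squares (DA k) true TLA F hF hsq⟩,
    ⟨(DB k).mod F hF, pfd_mod _ _ _, notB F hF σ hσ hFσ, squares (DB k) false TLB F hF hsq⟩⟩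

end PersistencePaper
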